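/- Let n ≥ 1, c ≥ 1 and m, l ∈ {0, …, c}. Let (b₁, b₂, e), with b₁, b₂ ∈ End(ℂᶜ) and e ∈ Hom(ℂᶜ, ℂ), satisfy conditions (T1) and (T2), and assume det(c_{m−l}·𝟏_c − s_{m−l}·b₁) ≠ 0, where c_{m−l} = cos(π(m−l)/(c+1)) and s_{m−l} = sin(π(m−l)/(c+1)). Then the triple (b₁', b₂', e) with b₁' = (c_{m−l}𝟏_c − s_{m−l}b₁)⁻¹(s_{m−l}𝟏_c + c_{m−l}b₁) and b₂' = (c_{m−l}𝟏_c − s_{m−l}b₁)ⁿ b₂ also satisfies conditions (T1) and (T2). -/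

import Mathlib

open Matrix BigOperators

noncomputable section

/-- The space of `c × c` complex matrices, regarded as endomorphisms of `ℂ^c`. -/
abbrev Mat (c : ℕ) : Type := Matrix (Fin c) (Fin c) ℂ

/-- `cos (π x / (c+1))` as a complex number. -/
def cmC (c : ℕ) (x : ℝ) : ℂ := Complex.ofReal (Real.cos (Real.pi * x / (c + 1)))

/-- `sin (π x / (c+1))` as a complex number. -/
def smC (c : ℕ) (x : ℝ) : ℂ := Complex.ofReal (Real.sin (Real.pi * x / (c + 1)))

/-- Condition (P1): for `n = 1`, `A₁C₁A₂ = A₂C₁A₁`; for `n > 1`,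
`A₁C_q = A₂C_{q+1}` and `C_qA₁ = C_{q+1}A₂` for `q = 1, …, n-1`. -/
def CondP1 (n c : ℕ) (A1 A2 : Mat c) (C : ℕ → Mat c) : Prop :=
  if n = 1 then A1 * C 1 * A2 = A2 * C 1 * A1
  else ∀ q : ℕ, 1 ≤ q → q ≤ n - 1 →
    A1 * C q = A2 * C (q + 1) ∧ C q * A1 = C (q + 1) * A2

/-- Condition (P2): the pencil `A₁ + λ A₂` is regular. -/
def CondP2 (c : ℕ) (A1 A2 : Mat c) : Prop :=
  ∃ ν1 ν2 : ℂ, (ν1 • A1 + ν2 • A2).det ≠ 0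

/-- Condition (P3). -/
def CondP3 (n c : ℕ) (A1 A2 : Mat c) (C : ℕ → Mat c) (e : Fin c → ℂ) : Prop :=
  ∀ l1 l2 m1 m2 : ℂ, (l1, l2) ≠ (0, 0) → l1 ^ n * m1 + l2 ^ n * m2 = 0 →
    ¬ ∃ v : Fin c → ℂ, v ≠ 0 ∧
      (C 1 * A2).mulVec v = (-m1) • v ∧
      (C n * A1).mulVec v = ((-1 : ℂ) ^ n * m2) • v ∧
      e ⬝ᵥ v = 0 ∧
      (l2 • A1 + l1 • A2).mulVec v = 0

/-- Condition (T1): `[b₁, b₂] = 0`. -/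
def CondT1 (c : ℕ) (b1 b2 : Mat c) : Prop := b1 * b2 = b2 * b1

/-- Condition (T2): co-stability of the ADHM datum `(b₁, b₂, e)`. -/
def CondT2 (c : ℕ) (b1 b2 : Mat c) (e : Fin c → ℂ) : Prop :=
  ∀ z w : ℂ, ¬ ∃ v : Fin c → ℂ, v ≠ 0 ∧
    b1.mulVec v = z • v ∧ b2.mulVec v = w • v ∧ e ⬝ᵥ v = 0

/-- `A_{1m} = c_m A₁ - s_m A₂`. -/
def Amat1 (c : ℕ) (m : ℝ) (A1 A2 : Mat c) : Mat c := cmC c m • A1 - smC c m • A2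

/-- `A_{2m} = s_m A₁ + c_m A₂`. -/
def Amat2 (c : ℕ) (m : ℝ) (A1 A2 : Mat c) : Mat c := smC c m • A1 + cmC c m • A2

/-- `B_m = A_{2m}⁻¹ A_{1m}`. -/
def Bmat (c : ℕ) (m : ℝ) (A1 A2 : Mat c) : Mat c :=
  (Amat2 c m A1 A2)⁻¹ * Amat1 c m A1 A2

/-- `E_m = (∑_{q=1}^{n} binom(n-1, q-1) c_m^{n-q} s_m^{q-1} C_q) A_{2m}`. -/
def Emat (n c : ℕ) (m : ℝ) (A1 A2 : Mat c) (C : ℕ → Mat c) : Mat c :=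
  (∑ q ∈ Finset.Icc 1 n,
    (((n - 1).choose (q - 1) : ℂ) * cmC c m ^ (n - q) * smC c m ^ (q - 1)) • C q) *
    Amat2 c m A1 A2

/-- A sub-representation `(S₀, S₁)`: `A₁(S₀) ⊆ S₁`, `A₂(S₀) ⊆ S₁`,
and `C_q(S₁) ⊆ S₀` for `q = 1, …, n`. -/
def SubRep (n c : ℕ) (A1 A2 : Mat c) (C : ℕ → Mat c)
    (S0 S1 : Submodule ℂ (Fin c → ℂ)) : Prop :=
  (∀ v ∈ S0, A1.mulVec v ∈ S1 ∧ A2.mulVec v ∈ S1) ∧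
  (∀ v ∈ S1, ∀ q : ℕ, 1 ≤ q → q ≤ n → (C q).mulVec v ∈ S0)

/-- Condition (Q1): for `n = 1`, `A₁C₁A₂ = A₂C₁A₁`; for `n ≥ 2`,
`A₁C_q = A₂C_{q+1}` and `C_qA₁ + f_q∘e = C_{q+1}A₂` for `q = 1, …, n-1`. -/
def CondQ1 (n c : ℕ) (A1 A2 : Mat c) (C : ℕ → Mat c) (e : Fin c → ℂ)
    (f : ℕ → Fin c → ℂ) : Prop :=
  if n = 1 then A1 * C 1 * A2 = A2 * C 1 * A1
  else ∀ q : ℕ, 1 ≤ q → q ≤ n - 1 →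
    A1 * C q = A2 * C (q + 1) ∧ C q * A1 + vecMulVec (f q) e = C (q + 1) * A2

/-- Condition (Q2). -/
def CondQ2 (n c : ℕ) (A1 A2 : Mat c) (C : ℕ → Mat c) (e : Fin c → ℂ) : Prop :=
  ∀ S0 S1 : Submodule ℂ (Fin c → ℂ), SubRep n c A1 A2 C S0 S1 →
    (∀ v ∈ S0, e ⬝ᵥ v = 0) →
    Module.finrank ℂ S0 ≤ Module.finrank ℂ S1 ∧
    (Module.finrank ℂ S0 = Module.finrank ℂ S1 → S0 = ⊥ ∧ S1 = ⊥)

/-- Condition (Q3) (with the framing maps `f_i`): for every sub-representation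
containing all the `Im f_i`, `dim S₀ ≤ dim S₁`; for `n = 1` there are no `f`'s
and the condition applies to every sub-representation. -/
def CondQ3 (n c : ℕ) (A1 A2 : Mat c) (C : ℕ → Mat c)
    (f : ℕ → Fin c → ℂ) : Prop :=
  ∀ S0 S1 : Submodule ℂ (Fin c → ℂ), SubRep n c A1 A2 C S0 S1 →
    (∀ i : ℕ, 1 ≤ i → i ≤ n - 1 → f i ∈ S0) →
    Module.finrank ℂ S0 ≤ Module.finrank ℂ S1

theorem cmC_sq_add_smC_sq (c : ℕ) (x : ℝ) : cmC c x ^ 2 + smC c x ^ 2 = 1 := by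
  unfold cmC smC
  norm_cast
  exact Real.cos_sq_add_sin_sq _

theorem CondT1.mobius {c : ℕ} {b1 b2 : Mat c} (h : CondT1 c b1 b2) (p q : ℂ) (n : ℕ)
    (hdet : (p • (1 : Mat c) - q • b1).det ≠ 0) :
    CondT1 c ((p • (1 : Mat c) - q • b1)⁻¹ * (q • (1 : Mat c) + p • b1))
      ((p • (1 : Mat c) - q • b1) ^ n * b2) := by
  set D : Mat c := p • (1 : Mat c) - q • b1 with hD
  have hb : Commute b1 b2 := h
  have hDx {x : Mat c} (hx : Commute b1 x) : Commute D x :=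
    ((Commute.one_left x).smul_left p).sub_left (hx.smul_left q)
  have hNx {x : Mat c} (hx : Commute b1 x) : Commute (q • (1 : Mat c) + p • b1) x :=
    ((Commute.one_left x).smul_left q).add_left (hx.smul_left p)
  have hinv {x : Mat c} (hx : Commute D x) : Commute D⁻¹ x := by
    have hu : IsUnit D.det := isUnit_iff_ne_zero.mpr hdet
    calc D⁻¹ * x = D⁻¹ * (x * D) * D⁻¹ := by
          rw [mul_assoc, mul_assoc, Matrix.mul_nonsing_inv D hu, mul_one]
      _ = x * D⁻¹ := by
          rw [← hx.eq, ← mul_assoc, Matrix.nonsing_inv_mul D hu, one_mul]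
  have hb1D : Commute b1 D := (hDx (Commute.refl b1)).symm
  exact ((hinv (Commute.refl D)).mul_left (hNx hb1D)).pow_right n |>.mul_right
    ((hinv (hDx hb)).mul_left (hNx hb))

theorem CondT2.mobius {c : ℕ} {b1 b2 : Mat c} {e : Fin c → ℂ} (hT1 : CondT1 c b1 b2)
    (hT2 : CondT2 c b1 b2 e) {p q : ℂ} (hpq : p ^ 2 + q ^ 2 = 1) (n : ℕ)
    (hdet : (p • (1 : Mat c) - q • b1).det ≠ 0) :
    CondT2 c ((p • (1 : Mat c) - q • b1)⁻¹ * (q • (1 : Mat c) + p • b1))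
      ((p • (1 : Mat c) - q • b1) ^ n * b2) e := by
  rintro z w ⟨v, hv, h1, h2, he⟩
  set D : Mat c := p • (1 : Mat c) - q • b1 with hD
  have hu : IsUnit D.det := isUnit_iff_ne_zero.mpr hdet
  have hDv : D *ᵥ v = p • v - q • (b1 *ᵥ v) := by
    simp [hD, Matrix.sub_mulVec, Matrix.smul_mulVec]
  have hN : q • v + p • (b1 *ᵥ v) = z • (D *ᵥ v) := by
    rw [← Matrix.mulVec_smul D z v, ← h1, Matrix.mulVec_mulVec, ← mul_assoc,
      Matrix.mul_nonsing_inv D hu, one_mul]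
    simp [Matrix.add_mulVec, Matrix.smul_mulVec]
  have hlin : (p + z * q) • (b1 *ᵥ v) = (z * p - q) • v := by
    rw [hDv] at hN
    linear_combination (norm := module) hN
  have hne : p + z * q ≠ 0 := by
    intro h0
    rw [h0, zero_smul] at hlin
    have h3 : z * p - q = 0 := (smul_eq_zero.mp hlin.symm).resolve_right hv
    have : (1 : ℂ) = 0 := by linear_combination -hpq + p * h0 - q * h3
    exact one_ne_zero this
  obtain ⟨x, hx⟩ : ∃ x : ℂ, b1 *ᵥ v = x • v :=
    ⟨(p + z * q)⁻¹ * (z * p - q), by rw [mul_smul, ← hlin, inv_smul_smul₀ hne]⟩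
  have hd : D *ᵥ v = (p - q * x) • v := by
    rw [hDv, hx, sub_smul, mul_smul]
  have hd0 : p - q * x ≠ 0 := by
    intro h0
    rw [h0, zero_smul] at hd
    exact hv (Matrix.eq_zero_of_mulVec_eq_zero hdet hd)
  have hpow (k : ℕ) : (D ^ k) *ᵥ v = (p - q * x) ^ k • v := by
    induction k with
    | zero => simp
    | succ k ih =>
      rw [pow_succ, ← Matrix.mulVec_mulVec, hd, Matrix.mulVec_smul, ih, smul_smul, pow_succ']
  have hcomm : Commute (D ^ n) b2 :=
    (((Commute.one_left b2).smul_left p).sub_left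
      ((show Commute b1 b2 from hT1).smul_left q)).pow_left n
  have hb2 : b2 *ᵥ v = (((p - q * x) ^ n)⁻¹ * w) • v := by
    rw [hcomm.eq, ← Matrix.mulVec_mulVec, hpow, Matrix.mulVec_smul] at h2
    rw [mul_smul, ← h2, inv_smul_smul₀ (pow_ne_zero n hd0)]
  exact hT2 x _ ⟨v, hv, hx, hb2, he⟩

/-- the ADHM transition functions preserve conditions (T1) and (T2). -/
theorem stmt_8 (n c m l : ℕ) (hn : 1 ≤ n) (hc : 1 ≤ c) (hm : m ≤ c) (hl : l ≤ c)
    (b1 b2 : Mat c) (e : Fin c → ℂ)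
    (hT1 : CondT1 c b1 b2) (hT2 : CondT2 c b1 b2 e)
    (hdet : (cmC c ((m : ℝ) - l) • (1 : Mat c) - smC c ((m : ℝ) - l) • b1).det ≠ 0) :
    CondT1 c
      ((cmC c ((m : ℝ) - l) • (1 : Mat c) - smC c ((m : ℝ) - l) • b1)⁻¹ *
        (smC c ((m : ℝ) - l) • (1 : Mat c) + cmC c ((m : ℝ) - l) • b1))
      ((cmC c ((m : ℝ) - l) • (1 : Mat c) - smC c ((m : ℝ) - l) • b1) ^ n * b2) ∧
    CondT2 c
      ((cmC c ((m : ℝ) - l) • (1 : Mat c) - smC c ((m : ℝ) - l) • b1)⁻¹ *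
        (smC c ((m : ℝ) - l) • (1 : Mat c) + cmC c ((m : ℝ) - l) • b1))
      ((cmC c ((m : ℝ) - l) • (1 : Mat c) - smC c ((m : ℝ) - l) • b1) ^ n * b2)
      e := by
  exact ⟨hT1.mobius _ _ n hdet, hT2.mobius hT1 (cmC_sq_add_smC_sq c _) n hdet⟩
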